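/- Let Ω = {θ_n}_{n≥1} ⊂ (0, π/2] be a lacunary sequence, i.e. θ_{n+1} ≤ A·θ_n for all n for some fixed 0 < A < 1. Then there exists a constant C > 0 such that for every N ≥ 2 and for every probability measure μ on the parameter space T = {(φ, p, w, h) ∈ [0, π/2] × [0,1]² × (0,1]² : φ ∈ Ω ∪ {0} and R(φ,p,w,h) ⊆ [0,1]²}, where R(φ,p,w,h) denotes the rectangle obtained by rotating [0,w] × [0,h] by angle φ and translating by p, there is a set P of N points in [0,1]² with (∫_T |#(P ∩ R(t)) − N·area(R(t))|² dμ(t))^{1/2} ≤ C (log N)^{5/2}. -/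

import Mathlib

open MeasureTheory

noncomputable section

/-- Rotation of the plane by angle `φ`. -/
def rot (φ : ℝ) (x : ℝ × ℝ) : ℝ × ℝ :=
  (x.1 * Real.cos φ - x.2 * Real.sin φ, x.1 * Real.sin φ + x.2 * Real.cos φ)

/-- The rectangle obtained by rotating `[0,w] × [0,h]` by angle `φ` and translating by `p`. -/
def rect (φ : ℝ) (p : ℝ × ℝ) (w h : ℝ) : Set (ℝ × ℝ) :=
  (fun x => p + rot φ x) '' (Set.Icc 0 w ×ˢ Set.Icc 0 h)

/-- The unit square `[0,1]²`. -/
def unitSq : Set (ℝ × ℝ) := Set.Icc (0:ℝ) 1 ×ˢ Set.Icc (0:ℝ) 1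

/-- `plog n = max {1, log₂ n}`. -/
def plog (n : ℕ) : ℝ := max 1 (Real.logb 2 n)

/-- The parameter space `T` of rectangles: tuples `(φ, p, w, h)` with
`φ ∈ (Ω ∪ {0}) ∩ [0, π/2]`, `p ∈ [0,1]²`, `w, h ∈ (0,1]`, and the corresponding
rectangle contained in `[0,1]²`. -/
def paramSet (Ω : Set ℝ) : Set (ℝ × (ℝ × ℝ) × ℝ × ℝ) :=
  {t | t.1 ∈ Set.Icc 0 (Real.pi / 2) ∧ (t.1 ∈ Ω ∨ t.1 = 0) ∧
       t.2.1 ∈ unitSq ∧ t.2.2.1 ∈ Set.Ioc (0:ℝ) 1 ∧ t.2.2.2 ∈ Set.Ioc (0:ℝ) 1 ∧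
       rect t.1 t.2.1 t.2.2.1 t.2.2.2 ⊆ unitSq}

section Walk

variable {σ E : Type*} [NormedAddCommGroup E] [InnerProductSpace ℝ E]

/-- The span of the vectors indexed by a finite set. -/
def spanOn (v : σ → E) (A : Finset σ) : Submodule ℝ E := Submodule.span ℝ (v '' A)

lemma spanOn_mono (v : σ → E) {A B : Finset σ} (h : A ⊆ B) : spanOn v A ≤ spanOn v B :=
  Submodule.span_mono (Set.image_mono (by exact_mod_cast h))

lemma mem_spanOn (v : σ → E) {A : Finset σ} {i : σ} (h : i ∈ A) : v i ∈ spanOn v A :=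
  Submodule.subset_span ⟨i, h, rfl⟩

variable [Fintype σ]

/-- The indices at which `x` is not integral. -/
def fracSet (x : σ → ℝ) : Finset σ := Finset.univ.filter fun i => 0 < x i ∧ x i < 1

lemma mem_fracSet {x : σ → ℝ} {i : σ} : i ∈ fracSet x ↔ 0 < x i ∧ x i < 1 := by
  simp [fracSet]

variable [DecidableEq σ]

/-- The error made when the fractional vector `x` is rounded to the indicator of `S`. -/
def roundErr (v : σ → E) (x : σ → ℝ) (S : Finset σ) : E :=
  ∑ i, ((if i ∈ S then (1 : ℝ) else 0) - x i) • v i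

/-- There is a random rounding of `x`, unbiased on the vectors `v`, whose error has second moment
at most `F θ` in every direction `θ`. -/
def HasRounding (v : σ → E) (x : σ → ℝ) (F : E → ℝ) : Prop :=
  ∃ w : Finset σ → ℝ, (∀ S, 0 ≤ w S) ∧ ∑ S, w S = 1 ∧
    (∀ θ, ∑ S, w S * inner ℝ θ (roundErr v x S) = 0) ∧
    ∀ θ, ∑ S, w S * (inner ℝ θ (roundErr v x S)) ^ 2 ≤ F θ

lemma HasRounding.mono {v : σ → E} {x : σ → ℝ} {F G : E → ℝ} (h : HasRounding v x F)
    (hFG : ∀ θ, F θ ≤ G θ) : HasRounding v x G := by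
  obtain ⟨w, h0, h1, h2, h3⟩ := h
  exact ⟨w, h0, h1, h2, fun θ => (h3 θ).trans (hFG θ)⟩

lemma roundErr_shift (v : σ → E) (x u : σ → ℝ) (δ : ℝ) (S : Finset σ) :
    roundErr v x S = roundErr v (x + δ • u) S + δ • ∑ i, u i • v i := by
  unfold roundErr
  rw [Finset.smul_sum, ← Finset.sum_add_distrib]
  refine Finset.sum_congr rfl fun i _ => ?_
  rw [smul_smul, ← add_smul]
  congr 1
  simp
  ring

lemma roundErr_moments {v : σ → E} {x u : σ → ℝ} {δ : ℝ} {w : Finset σ → ℝ} {θ : E} {c : ℝ}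
    (h1 : ∑ S, w S = 1) (h2 : ∑ S, w S * inner ℝ θ (roundErr v (x + δ • u) S) = 0)
    (h3 : ∑ S, w S * (inner ℝ θ (roundErr v (x + δ • u) S)) ^ 2 ≤ c) :
    ∑ S, w S * inner ℝ θ (roundErr v x S) = δ * inner ℝ θ (∑ i, u i • v i) ∧
    ∑ S, w S * (inner ℝ θ (roundErr v x S)) ^ 2 ≤ c + δ ^ 2 * (inner ℝ θ (∑ i, u i • v i)) ^ 2 := by
  set b := ∑ i, u i • v i
  have key : ∀ S, inner ℝ θ (roundErr v x S) =
      inner ℝ θ (roundErr v (x + δ • u) S) + δ * inner ℝ θ b := fun S => by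
    rw [roundErr_shift v x u δ S, inner_add_right, inner_smul_right]
  constructor
  · simp_rw [key, mul_add, Finset.sum_add_distrib, h2, ← Finset.sum_mul, h1]
    ring
  · have : ∀ S, w S * (inner ℝ θ (roundErr v x S)) ^ 2 =
        w S * (inner ℝ θ (roundErr v (x + δ • u) S)) ^ 2 +
        (w S * inner ℝ θ (roundErr v (x + δ • u) S)) * (2 * δ * inner ℝ θ b) +
        w S * (δ * inner ℝ θ b) ^ 2 := fun S => by rw [key]; ring
    simp_rw [this, Finset.sum_add_distrib, ← Finset.sum_mul, h2, h1]
    nlinarith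

lemma HasRounding.combine {v : σ → E} {x u : σ → ℝ} {F₁ F₂ : E → ℝ} {δ₁ δ₂ : ℝ}
    (hδ₁ : 0 < δ₁) (hδ₂ : 0 < δ₂)
    (h₁ : HasRounding v (x + δ₁ • u) F₁) (h₂ : HasRounding v (x + (-δ₂) • u) F₂) :
    HasRounding v x (fun θ =>
      δ₂ / (δ₁ + δ₂) * (F₁ θ + δ₁ ^ 2 * (inner ℝ θ (∑ i, u i • v i)) ^ 2) +
      δ₁ / (δ₁ + δ₂) * (F₂ θ + (-δ₂) ^ 2 * (inner ℝ θ (∑ i, u i • v i)) ^ 2)) := by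
  obtain ⟨w, w0, w1, w2, w3⟩ := h₁
  obtain ⟨z, z0, z1, z2, z3⟩ := h₂
  refine ⟨fun S => δ₂ / (δ₁ + δ₂) * w S + δ₁ / (δ₁ + δ₂) * z S, fun S => ?_, ?_, fun θ => ?_,
    fun θ => ?_⟩
  · have := w0 S; have := z0 S; positivity
  · rw [Finset.sum_add_distrib, ← Finset.mul_sum, ← Finset.mul_sum, w1, z1]
    field_simp
    ring
  · have a := (roundErr_moments w1 (w2 θ) (w3 θ)).1
    have b := (roundErr_moments z1 (z2 θ) (z3 θ)).1
    simp_rw [add_mul, mul_assoc, Finset.sum_add_distrib, ← Finset.mul_sum, a, b]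
    field_simp
    ring
  · have a := (roundErr_moments w1 (w2 θ) (w3 θ)).2
    have b := (roundErr_moments z1 (z2 θ) (z3 θ)).2
    simp_rw [add_mul, mul_assoc, Finset.sum_add_distrib, ← Finset.mul_sum]
    gcongr

lemma exists_step_fracSet {x u : σ → ℝ} (hx : ∀ i, x i ∈ Set.Icc (0 : ℝ) 1)
    (hu : ∀ i, i ∉ fracSet x → u i = 0) {p : σ} (hp : u p ≠ 0) :
    ∃ δ : ℝ, 0 < δ ∧ (∀ i, (x + δ • u) i ∈ Set.Icc (0 : ℝ) 1) ∧
      fracSet (x + δ • u) ⊂ fracSet x := by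
  let f : σ → ℝ := fun i => if 0 < u i then (1 - x i) / u i else x i / (-u i)
  have hfrac : ∀ i, u i ≠ 0 → 0 < x i ∧ x i < 1 := fun i hi => by
    by_contra h
    exact hi (hu i fun h' => h (mem_fracSet.1 h'))
  obtain ⟨k, hk, hmin⟩ := Finset.exists_min_image (Finset.univ.filter fun i => u i ≠ 0) f
    ⟨p, by simpa using hp⟩
  simp only [Finset.mem_filter, Finset.mem_univ, true_and] at hk hmin
  have hfpos : ∀ i, u i ≠ 0 → 0 < f i := fun i hi => by
    have := hfrac i hi
    rcases lt_or_gt_of_ne hi with h | h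
    · simp only [f, not_lt.2 h.le, if_false]
      exact div_pos this.1 (by linarith)
    · simp only [f, h, if_true]
      exact div_pos (by linarith) h
  have hcube : ∀ i, (x + f k • u) i ∈ Set.Icc (0 : ℝ) 1 := fun i => by
    simp only [Pi.add_apply, Pi.smul_apply, smul_eq_mul]
    by_cases hi : u i = 0
    · simpa [hi] using hx i
    have h1 := hmin i hi
    have h2 := hfrac i hi
    have h3 := hfpos k hk
    rcases lt_or_gt_of_ne hi with h | h
    · rw [show f i = x i / (-u i) by simp only [f, not_lt.2 h.le, if_false],
        le_div_iff₀ (by linarith)] at h1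
      constructor <;> nlinarith
    · rw [show f i = (1 - x i) / u i by simp only [f, h, if_true], le_div_iff₀ h] at h1
      constructor <;> nlinarith
  refine ⟨f k, hfpos k hk, hcube, ?_⟩
  rw [Finset.ssubset_iff_of_subset]
  · refine ⟨k, mem_fracSet.2 (hfrac k hk), fun h => ?_⟩
    rw [mem_fracSet] at h
    simp only [Pi.add_apply, Pi.smul_apply, smul_eq_mul] at h
    rcases lt_or_gt_of_ne hk with h' | h'
    · rw [show f k = x k / (-u k) by simp only [f, not_lt.2 h'.le, if_false]] at h
      have : x k + x k / (-u k) * u k = 0 := by field_simp; ring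
      linarith
    · rw [show f k = (1 - x k) / u k by simp only [f, h', if_true]] at h
      have : x k + (1 - x k) / u k * u k = 1 := by field_simp; ring
      linarith
  · intro i hi
    by_contra h
    rw [mem_fracSet] at hi
    simp only [Pi.add_apply, Pi.smul_apply, smul_eq_mul, hu i h, mul_zero, add_zero] at hi
    exact h (mem_fracSet.2 hi)

/-- The weight of the pivot direction, for a pivot with value `x` and squared residual `β`. -/
def pivotWeight (x β : ℝ) : ℝ := 4 * x * (1 - x) / (1 + β * (4 * x * (1 - x)))

lemma pivotWeight_nonneg {x β : ℝ} (hx : x ∈ Set.Icc (0 : ℝ) 1) (hβ : 0 ≤ β) :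
    0 ≤ pivotWeight x β := by
  have h : 0 ≤ 4 * x * (1 - x) := by nlinarith [hx.1, hx.2, mul_nonneg hx.1 (sub_nonneg.2 hx.2)]
  unfold pivotWeight
  positivity

/-- A supporting line of `z ↦ pivotWeight z β + z ^ 2`. -/
lemma pivotWeight_add_sq_le {x z β : ℝ} (hx : x ∈ Set.Icc (0 : ℝ) 1) (hz : z ∈ Set.Icc (0 : ℝ) 1)
    (hβ : 0 ≤ β) (hβ' : β ≤ 1) :
    pivotWeight z β + (z - x) ^ 2 ≤
      pivotWeight x β + 4 * (1 - 2 * x) / (1 + β * (4 * x * (1 - x))) ^ 2 * (z - x) := by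
  have hy : 0 ≤ 4 * x * (1 - x) := by nlinarith [mul_nonneg hx.1 (sub_nonneg.2 hx.2)]
  have hY : 0 ≤ 4 * z * (1 - z) := by nlinarith [mul_nonneg hz.1 (sub_nonneg.2 hz.2)]
  have hy1 : 4 * x * (1 - x) ≤ 1 := by nlinarith [sq_nonneg (2 * x - 1)]
  have hYy : 4 * z * (1 - z) = 4 * x * (1 - x) + 4 * (1 - 2 * x) * (z - x) - 4 * (z - x) ^ 2 := by
    ring
  unfold pivotWeight
  generalize 4 * x * (1 - x) = y at *
  generalize 4 * z * (1 - z) = Y at *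
  have hc : 0 < 1 + β * y := by positivity
  have hC : 0 < 1 + β * Y := by positivity
  have htan : Y / (1 + β * Y) ≤ y / (1 + β * y) + (Y - y) / (1 + β * y) ^ 2 := by
    rw [div_add_div _ _ hc.ne' (by positivity), div_le_div_iff₀ hC (by positivity)]
    have : 0 ≤ (1 + β * y) * (β * (Y - y) ^ 2) := by positivity
    nlinarith
  have hsq : (z - x) ^ 2 ≤ 4 * (z - x) ^ 2 / (1 + β * y) ^ 2 := by
    rw [le_div_iff₀ (by positivity)]
    have h1 : β * y ≤ 1 := mul_le_one₀ hβ' hy hy1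
    have h2 : (1 + β * y) ^ 2 ≤ 4 := by nlinarith [mul_nonneg hβ hy]
    nlinarith [sq_nonneg (z - x)]
  have : (Y - y) / (1 + β * y) ^ 2 =
      4 * (1 - 2 * x) / (1 + β * y) ^ 2 * (z - x) - 4 * (z - x) ^ 2 / (1 + β * y) ^ 2 := by
    rw [hYy]; ring
  linarith

lemma pivotWeight_step {x δ₁ δ₂ β : ℝ} (hx : x ∈ Set.Icc (0 : ℝ) 1)
    (h₁ : x + δ₁ ∈ Set.Icc (0 : ℝ) 1) (h₂ : x - δ₂ ∈ Set.Icc (0 : ℝ) 1)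
    (hδ₁ : 0 < δ₁) (hδ₂ : 0 < δ₂) (hβ : 0 ≤ β) (hβ' : β ≤ 1) :
    δ₂ / (δ₁ + δ₂) * (pivotWeight (x + δ₁) β + δ₁ ^ 2) +
      δ₁ / (δ₁ + δ₂) * (pivotWeight (x - δ₂) β + δ₂ ^ 2) ≤ pivotWeight x β := by
  have a := pivotWeight_add_sq_le hx h₁ hβ hβ'
  have b := pivotWeight_add_sq_le hx h₂ hβ hβ'
  generalize 4 * (1 - 2 * x) / (1 + β * (4 * x * (1 - x))) ^ 2 = m at *
  rw [add_sub_cancel_left] at a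
  rw [sub_sub_cancel_left, neg_sq] at b
  calc _ ≤ δ₂ / (δ₁ + δ₂) * (pivotWeight x β + m * δ₁) +
      δ₁ / (δ₁ + δ₂) * (pivotWeight x β + m * -δ₂) := by gcongr
    _ = _ := by field_simp; ring

lemma hasRounding_of_fracSet_eq_empty (v : σ → E) {x : σ → ℝ}
    (hx : ∀ i, x i ∈ Set.Icc (0 : ℝ) 1) (h : fracSet x = ∅) : HasRounding v x 0 := by
  classical
  let S₀ : Finset σ := Finset.univ.filter fun i => x i = 1
  have h0 : roundErr v x S₀ = 0 := by
    refine Finset.sum_eq_zero fun i _ => ?_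
    have hi : i ∉ fracSet x := by simp [h]
    rw [mem_fracSet] at hi
    by_cases h1 : x i = 1
    · simp [S₀, h1]
    · have h2 : x i = 0 := by
        by_contra h2
        exact hi ⟨lt_of_le_of_ne (hx i).1 (Ne.symm h2), lt_of_le_of_ne (hx i).2 h1⟩
      simp [S₀, h2]
  refine ⟨fun S => if S = S₀ then 1 else 0, fun S => ?_, ?_, fun θ => ?_, fun θ => ?_⟩
  · dsimp only; split_ifs <;> norm_num
  · simp
  · simp [h0]
  · simp [h0]

variable [FiniteDimensional ℝ E]

lemma pivotWeight_mul_sq_le {x β s B R D : ℝ} (hx : x ∈ Set.Icc (0 : ℝ) 1) (hβ : 0 ≤ β)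
    (hR : |R| ≤ s * D) :
    pivotWeight x (β + s ^ 2) * (B + R) ^ 2 ≤ pivotWeight x β * B ^ 2 + D ^ 2 := by
  have hy : 0 ≤ 4 * x * (1 - x) := by nlinarith [mul_nonneg hx.1 (sub_nonneg.2 hx.2)]
  unfold pivotWeight
  generalize 4 * x * (1 - x) = y at *
  have hp : 0 < 1 + β * y := by positivity
  have hq : 0 < 1 + (β + s ^ 2) * y := by positivity
  rw [div_mul_eq_mul_div, div_mul_eq_mul_div, div_add' _ _ _ hp.ne', div_le_div_iff₀ hq hp]
  have hRR : R ^ 2 ≤ s ^ 2 * D ^ 2 := by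
    rw [← sq_abs, ← mul_pow]
    gcongr
  have hBR : B * R ≤ |B| * (s * D) := by
    calc B * R ≤ |B * R| := le_abs_self _
      _ = |B| * |R| := abs_mul _ _
      _ ≤ _ := by gcongr
  have e : (1 + (β + s ^ 2) * y) = (1 + β * y) + s ^ 2 * y := by ring
  rw [e]
  generalize 1 + β * y = p at *
  have h1 := mul_le_mul_of_nonneg_left hRR (mul_nonneg hy hp.le)
  have h2 := mul_le_mul_of_nonneg_left hBR (mul_nonneg hy hp.le)
  have h3 := sq_nonneg (p * D - s * y * |B|)
  have h4 := sq_abs B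
  have h5 : (s * y * |B|) ^ 2 = s ^ 2 * y ^ 2 * B ^ 2 := by rw [mul_pow, h4]; ring
  nlinarith

lemma starProjection_add_pivot_mono {L L' : Submodule ℝ E} (hL : L' ≤ L) (v θ : E) {x : ℝ}
    (hx : x ∈ Set.Icc (0 : ℝ) 1) :
    ‖L'.starProjection θ‖ ^ 2 + pivotWeight x (‖v - L'.starProjection v‖ ^ 2) *
      (inner ℝ θ (v - L'.starProjection v)) ^ 2 ≤
    ‖L.starProjection θ‖ ^ 2 + pivotWeight x (‖v - L.starProjection v‖ ^ 2) *
      (inner ℝ θ (v - L.starProjection v)) ^ 2 := by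
  have ha := L.starProjection_apply_mem θ
  have ha' := L'.starProjection_apply_mem θ
  have hv := L.starProjection_apply_mem v
  have hv' := L'.starProjection_apply_mem v
  have oθ := fun w hw => L.starProjection_inner_eq_zero θ w hw
  have oθ' := fun w hw => L'.starProjection_inner_eq_zero θ w hw
  have ov := fun w hw => L.starProjection_inner_eq_zero v w hw
  have ov' := fun w hw => L'.starProjection_inner_eq_zero v w hw
  generalize L.starProjection θ = a at *
  generalize L'.starProjection θ = a' at *
  generalize L.starProjection v = c at *
  generalize L'.starProjection v = c' at *
  have hr : c - c' ∈ L := L.sub_mem hv (hL hv')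
  have e1 : ‖a‖ ^ 2 = ‖a'‖ ^ 2 + ‖a - a'‖ ^ 2 := by
    have h1 := oθ a' (hL ha')
    have h2 := oθ' a' ha'
    have : inner ℝ (a - a') a' = 0 := by
      rw [show a - a' = (θ - a') - (θ - a) by abel, inner_sub_left, h1, h2, sub_zero]
    have h3 := norm_add_sq_real (a - a') a'
    rw [sub_add_cancel, this] at h3
    linarith
  have e2 : ‖v - c'‖ ^ 2 = ‖v - c‖ ^ 2 + ‖c - c'‖ ^ 2 := by
    have h3 := norm_add_sq_real (v - c) (c - c')
    rw [sub_add_sub_cancel, ov _ hr] at h3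
    linarith
  have e3 : inner ℝ θ (v - c') = inner ℝ θ (v - c) + inner ℝ θ (c - c') := by
    rw [← inner_add_right, sub_add_sub_cancel]
  have e4 : inner ℝ θ (c - c') = inner ℝ (a - a') (c - c') := by
    have h1 := oθ _ hr
    have h2 : inner ℝ a' (c - c') = 0 := by
      rw [real_inner_comm, show c - c' = (v - c') - (v - c) by abel, inner_sub_left,
        ov _ (hL ha'), ov' _ ha', sub_zero]
    rw [inner_sub_left] at h1
    rw [inner_sub_left, h2]
    linarith
  rw [e1, e2, e3, add_assoc]
  have := pivotWeight_mul_sq_le (B := inner ℝ θ (v - c)) hx (sq_nonneg ‖v - c‖)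
    (s := ‖c - c'‖) (D := ‖a - a'‖) (R := inner ℝ θ (c - c'))
    (by rw [e4, mul_comm]; exact abs_real_inner_le_norm _ _)
  linarith

lemma starProjection_norm_mono {L L' : Submodule ℝ E} (hL : L' ≤ L) (θ : E) :
    ‖L'.starProjection θ‖ ^ 2 ≤ ‖L.starProjection θ‖ ^ 2 := by
  simpa [pivotWeight] using starProjection_add_pivot_mono hL 0 θ (x := 0) (by simp)

lemma starProjection_add_pivot_le {L M : Submodule ℝ E} (hL : L ≤ M) {v : E} (hv : v ∈ M) (θ : E)
    {x : ℝ} (hx : x ∈ Set.Icc (0 : ℝ) 1) :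
    ‖L.starProjection θ‖ ^ 2 + pivotWeight x (‖v - L.starProjection v‖ ^ 2) *
      (inner ℝ θ (v - L.starProjection v)) ^ 2 ≤ ‖M.starProjection θ‖ ^ 2 := by
  have := starProjection_add_pivot_mono hL v θ hx
  rwa [Submodule.starProjection_eq_self_iff.2 hv, sub_self, inner_zero_right, zero_pow two_ne_zero,
    mul_zero, add_zero] at this

lemma exists_pivot_direction (v : σ → E) {A : Finset σ} {p : σ} (hp : p ∈ A) :
    ∃ u : σ → ℝ, u p = 1 ∧ (∀ i, i ∉ A → u i = 0) ∧
      ∑ i, u i • v i = v p - (spanOn v (A.erase p)).starProjection (v p) := by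
  have h := (spanOn v (A.erase p)).starProjection_apply_mem (v p)
  set c := (spanOn v (A.erase p)).starProjection (v p)
  obtain ⟨f, hf⟩ := (Submodule.mem_span_image_finset_iff_exists_fun' ℝ).1 h
  refine ⟨fun i => if i = p then 1 else if i ∈ A then -f i else 0, by simp, ?_, ?_⟩
  · intro i hi
    have : i ≠ p := fun h => hi (h ▸ hp)
    simp [this, hi]
  · rw [← hf, ← Finset.sum_subset (Finset.subset_univ A), ← Finset.add_sum_erase _ _ hp,
      sub_eq_add_neg, ← Finset.sum_neg_distrib]
    · congr 1
      · simp
      · refine Finset.sum_congr rfl fun i hi => ?_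
        rw [Finset.mem_erase] at hi
        simp [hi.1, hi.2]
    · intro i _ hi
      have : i ≠ p := fun h => hi (h ▸ hp)
      simp [this, hi]

/-- The Gram–Schmidt walk rounds any fractional vector with error covariance dominated by the
projection onto the span of the vectors with fractional coefficients. -/
theorem hasRounding_fracSet {v : σ → E} (hv : ∀ i, ‖v i‖ ≤ 1) (n : ℕ) :
    ∀ x : σ → ℝ, (∀ i, x i ∈ Set.Icc (0 : ℝ) 1) → (fracSet x).card = n →
      HasRounding v x (fun θ => ‖(spanOn v (fracSet x)).starProjection θ‖ ^ 2) ∧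
      ∀ p ∈ fracSet x, HasRounding v x (fun θ =>
        ‖(spanOn v ((fracSet x).erase p)).starProjection θ‖ ^ 2 +
        pivotWeight (x p) (‖v p - (spanOn v ((fracSet x).erase p)).starProjection (v p)‖ ^ 2) *
        (inner ℝ θ (v p - (spanOn v ((fracSet x).erase p)).starProjection (v p))) ^ 2) := by
  induction n using Nat.strong_induction_on with
  | _ n ih =>
  intro x hx hn
  have hpiv : ∀ p ∈ fracSet x, HasRounding v x (fun θ =>
        ‖(spanOn v ((fracSet x).erase p)).starProjection θ‖ ^ 2 +
        pivotWeight (x p) (‖v p - (spanOn v ((fracSet x).erase p)).starProjection (v p)‖ ^ 2) *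
        (inner ℝ θ (v p - (spanOn v ((fracSet x).erase p)).starProjection (v p))) ^ 2) := by
    intro p hp
    obtain ⟨u, hup, hu0, hub⟩ := exists_pivot_direction v hp
    set L := spanOn v ((fracSet x).erase p) with hL
    set b := v p - L.starProjection (v p) with hb
    have hbranch : ∀ x' : σ → ℝ, (∀ i, x' i ∈ Set.Icc (0 : ℝ) 1) → fracSet x' ⊂ fracSet x →
        HasRounding v x' (fun θ => ‖L.starProjection θ‖ ^ 2 +
          pivotWeight (x' p) (‖b‖ ^ 2) * (inner ℝ θ b) ^ 2) := by
      intro x' hx' hss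
      obtain ⟨i1, i2⟩ := ih _ (hn ▸ Finset.card_lt_card hss) x' hx' rfl
      by_cases hp' : p ∈ fracSet x'
      · exact (i2 p hp').mono fun θ => starProjection_add_pivot_mono
          (spanOn_mono v (Finset.erase_subset_erase p hss.1)) (v p) θ (hx' p)
      · refine i1.mono fun θ => ?_
        have h1 := starProjection_norm_mono (spanOn_mono v
          (show fracSet x' ⊆ (fracSet x).erase p from fun i hi =>
            Finset.mem_erase.2 ⟨fun h => hp' (h ▸ hi), hss.1 hi⟩)) θ
        have h2 := mul_nonneg (pivotWeight_nonneg (hx' p) (sq_nonneg ‖b‖))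
          (sq_nonneg (inner ℝ θ b))
        linarith
    obtain ⟨δ₁, hδ₁, c₁, s₁⟩ := exists_step_fracSet hx hu0 (p := p) (by simp [hup])
    obtain ⟨δ₂, hδ₂, c₂, s₂⟩ := exists_step_fracSet (u := -u) hx
      (fun i hi => by simp [hu0 i hi]) (p := p) (by simp [hup])
    rw [smul_neg, ← neg_smul] at c₂ s₂
    refine ((hbranch _ c₁ s₁).combine hδ₁ hδ₂ (hbranch _ c₂ s₂)).mono fun θ => ?_
    rw [hub]
    have e₁ : (x + δ₁ • u) p = x p + δ₁ := by simp [hup]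
    have e₂ : (x + (-δ₂) • u) p = x p - δ₂ := by simp [hup, sub_eq_add_neg]
    have hβ : ‖b‖ ^ 2 ≤ 1 := by
      have h1 := norm_sub_sq_real (v p) (L.starProjection (v p))
      have h2 := L.starProjection_inner_eq_zero (v p) _ (L.starProjection_apply_mem (v p))
      rw [inner_sub_left, real_inner_self_eq_norm_sq] at h2
      have h3 : ‖v p‖ ^ 2 ≤ 1 := pow_le_one₀ (norm_nonneg _) (hv p)
      have h4 := sq_nonneg ‖L.starProjection (v p)‖
      linarith
    have k₁ := c₁ p
    have k₂ := c₂ p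
    rw [e₁] at k₁ ⊢
    rw [e₂] at k₂ ⊢
    have key := mul_le_mul_of_nonneg_right
      (pivotWeight_step (hx p) k₁ k₂ hδ₁ hδ₂ (sq_nonneg ‖b‖) hβ) (sq_nonneg (inner ℝ θ b))
    have hsum : δ₂ / (δ₁ + δ₂) + δ₁ / (δ₁ + δ₂) = 1 := by field_simp; ring
    have hsum' : (δ₂ / (δ₁ + δ₂) + δ₁ / (δ₁ + δ₂)) * ‖L.starProjection θ‖ ^ 2 =
        ‖L.starProjection θ‖ ^ 2 := by rw [hsum, one_mul]
    nlinarith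
  refine ⟨?_, hpiv⟩
  rcases (fracSet x).eq_empty_or_nonempty with h | ⟨p, hp⟩
  · exact (hasRounding_of_fracSet_eq_empty v hx h).mono fun θ => sq_nonneg _
  · exact (hpiv p hp).mono fun θ => starProjection_add_pivot_le
      (spanOn_mono v (Finset.erase_subset _ _)) (mem_spanOn v hp) θ (hx p)

theorem hasRounding_of_norm_sq_le {v : σ → E} {K : ℝ} (hK : 0 < K) (hv : ∀ i, ‖v i‖ ^ 2 ≤ K)
    {x : σ → ℝ} (hx : ∀ i, x i ∈ Set.Icc (0 : ℝ) 1) :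
    HasRounding v x (fun θ => K * ‖θ‖ ^ 2) := by
  have hs : 0 < Real.sqrt K := Real.sqrt_pos.2 hK
  obtain ⟨w, w0, w1, w2, w3⟩ := (hasRounding_fracSet (v := fun i => (Real.sqrt K)⁻¹ • v i)
    (fun i => by
      rw [norm_smul, Real.norm_of_nonneg (by positivity), inv_mul_le_one₀ hs]
      exact Real.le_sqrt_of_sq_le (hv i)) _ x hx rfl).1
  have e : ∀ S, roundErr v x S = Real.sqrt K • roundErr (fun i => (Real.sqrt K)⁻¹ • v i) x S := by
    intro S
    unfold roundErr
    rw [Finset.smul_sum]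
    refine Finset.sum_congr rfl fun i _ => ?_
    rw [smul_comm, smul_inv_smul₀ hs.ne']
  refine ⟨w, w0, w1, fun θ => ?_, fun θ => ?_⟩
  · simp_rw [e, inner_smul_right, mul_left_comm _ (Real.sqrt K), ← Finset.mul_sum, w2, mul_zero]
  · simp_rw [e, inner_smul_right, mul_pow, Real.sq_sqrt hK.le, mul_left_comm _ K, ← Finset.mul_sum]
    refine mul_le_mul_of_nonneg_left ((w3 θ).trans ?_) hK.le
    exact pow_le_pow_left₀ (norm_nonneg _) (Submodule.norm_starProjection_apply_le _ _) 2

end Walk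

section Boxes

lemma sum_dyadic_eq_ite_lt (L : ℕ) : ∀ r j : ℕ, r < 2 ^ L → j < 2 ^ L →
    ∑ l ∈ Finset.range L,
      (if (j / 2 ^ l) % 2 = 1 ∧ r / 2 ^ l + 1 = j / 2 ^ l then (1 : ℝ) else 0) =
      if r < j then 1 else 0 := by
  induction L with
  | zero =>
    intro r j hr hj
    have : ¬ r < j := by simp at hr hj; omega
    simp [this]
  | succ L ih =>
    intro r j hr hj
    rw [pow_succ] at hr hj
    have := ih (r / 2) (j / 2) (by omega) (by omega)
    simp only [Nat.div_div_eq_div_mul, ← pow_succ'] at this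
    rw [Finset.sum_range_succ', this]
    simp only [pow_zero, Nat.div_one]
    by_cases h1 : r / 2 < j / 2
    · rw [if_pos h1, if_neg (by omega), if_pos (by omega), add_zero]
    · by_cases h2 : j % 2 = 1 ∧ r + 1 = j
      · rw [if_neg h1, if_pos h2, if_pos (by omega), zero_add]
      · rw [if_neg h1, if_neg h2, if_neg (by omega), add_zero]

/-- Incidence of the number `r` with the dyadic intervals. -/
def dyadicPoint (L r : ℕ) (a : Fin L × Fin (2 ^ L)) : ℝ := if r / 2 ^ (a.1 : ℕ) = a.2 then 1 else 0

/-- The dyadic intervals decomposing `[0, j)`. -/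
def dyadicPrefix (L j : ℕ) (a : Fin L × Fin (2 ^ L)) : ℝ :=
  if (j / 2 ^ (a.1 : ℕ)) % 2 = 1 ∧ (a.2 : ℕ) + 1 = j / 2 ^ (a.1 : ℕ) then 1 else 0

lemma sum_dyadicPrefix_mul_dyadicPoint {L r j : ℕ} (hr : r < 2 ^ L) (hj : j < 2 ^ L) :
    ∑ a, dyadicPrefix L j a * dyadicPoint L r a = if r < j then 1 else 0 := by
  rw [← sum_dyadic_eq_ite_lt L r j hr hj, Fintype.sum_prod_type, Finset.sum_range]
  refine Finset.sum_congr rfl fun l _ => ?_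
  rw [Finset.sum_eq_single (⟨r / 2 ^ (l : ℕ), (Nat.div_le_self _ _).trans_lt hr⟩ : Fin (2 ^ L))]
  · simp [dyadicPrefix, dyadicPoint]
  · intro c _ hc
    have : r / 2 ^ (l : ℕ) ≠ c := fun h => hc (Fin.ext h.symm)
    simp [dyadicPoint, this]
  · simp

lemma sum_ite_sq_le_one {n : ℕ} (P : Fin n → Prop) [DecidablePred P]
    (h : ∀ a b, P a → P b → a = b) : ∑ a, (if P a then (1 : ℝ) else 0) ^ 2 ≤ 1 := by
  have : ∀ a, (if P a then (1 : ℝ) else 0) ^ 2 = if P a then 1 else 0 := fun a => by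
    split_ifs <;> norm_num
  simp_rw [this, Finset.sum_boole]
  exact_mod_cast Finset.card_le_one.2 fun a ha b hb =>
    h a b (Finset.mem_filter.1 ha).2 (Finset.mem_filter.1 hb).2

lemma sum_dyadicPoint_sq_le (L r : ℕ) : ∑ a, dyadicPoint L r a ^ 2 ≤ L := by
  rw [Fintype.sum_prod_type]
  calc _ ≤ ∑ _l : Fin L, (1 : ℝ) := Finset.sum_le_sum fun l _ =>
        sum_ite_sq_le_one (fun c : Fin (2 ^ L) => r / 2 ^ (l : ℕ) = c)
          fun a b ha hb => Fin.ext (ha.symm.trans hb)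
    _ = L := by simp

lemma sum_dyadicPrefix_sq_le (L j : ℕ) : ∑ a, dyadicPrefix L j a ^ 2 ≤ L := by
  rw [Fintype.sum_prod_type]
  calc _ ≤ ∑ _l : Fin L, (1 : ℝ) := Finset.sum_le_sum fun l _ =>
        sum_ite_sq_le_one
          (fun c : Fin (2 ^ L) => (j / 2 ^ (l : ℕ)) % 2 = 1 ∧ (c : ℕ) + 1 = j / 2 ^ (l : ℕ))
          fun a b ha hb => Fin.ext (by omega)
    _ = L := by simp

lemma sum_dyadicPrefix_sub_sq_le (L j k : ℕ) :
    ∑ a, (dyadicPrefix L j a - dyadicPrefix L k a) ^ 2 ≤ 4 * L := by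
  have h1 := sum_dyadicPrefix_sq_le L j
  have h2 := sum_dyadicPrefix_sq_le L k
  calc ∑ a, (dyadicPrefix L j a - dyadicPrefix L k a) ^ 2
      ≤ ∑ a, (2 * dyadicPrefix L j a ^ 2 + 2 * dyadicPrefix L k a ^ 2) :=
        Finset.sum_le_sum fun a _ => by
          nlinarith [sq_nonneg (dyadicPrefix L j a + dyadicPrefix L k a)]
    _ ≤ 4 * L := by
      rw [Finset.sum_add_distrib, ← Finset.mul_sum, ← Finset.mul_sum]
      linarith

lemma euclidean_inner_eq_sum {I : Type*} [Fintype I] (u v : EuclideanSpace ℝ I) :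
    inner ℝ u v = ∑ a, u a * v a := by
  simp only [PiLp.inner_apply, RCLike.inner_apply, conj_trivial]
  exact Finset.sum_congr rfl fun a _ => mul_comm _ _

lemma sum_sum_mul_mul_mul {I J : Type*} [Fintype I] [Fintype J] (p r : I → ℝ) (q s : J → ℝ) :
    ∑ a, ∑ b, p a * q b * (r a * s b) = (∑ a, p a * r a) * ∑ b, q b * s b := by
  rw [Fintype.sum_mul_sum]
  exact Finset.sum_congr rfl fun a _ => Finset.sum_congr rfl fun b _ => mul_mul_mul_comm _ _ _ _

variable {D σ : Type*} [Fintype D] [Fintype σ]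

/-- The number of indices at which `f` is smaller than at `i`. -/
def rankOf (f : σ → ℝ) (i : σ) : ℕ := (Finset.univ.filter fun k => f k < f i).card

lemma rankOf_lt_card_le_iff (f : σ → ℝ) (i : σ) (b : ℝ) :
    rankOf f i < (Finset.univ.filter fun k => f k ≤ b).card ↔ f i ≤ b := by
  constructor
  · intro h
    by_contra hb
    refine absurd h (not_lt.2 (Finset.card_le_card fun k hk => ?_))
    simp only [Finset.mem_filter, Finset.mem_univ, true_and] at hk ⊢
    linarith
  · intro h
    refine Finset.card_lt_card ((Finset.ssubset_iff_of_subset fun k hk => ?_).2 ⟨i, ?_, ?_⟩)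
    · simp only [Finset.mem_filter, Finset.mem_univ, true_and] at hk ⊢
      linarith
    · simpa using h
    · simp

lemma rankOf_lt_card_lt_iff (f : σ → ℝ) (i : σ) (a : ℝ) :
    rankOf f i < (Finset.univ.filter fun k => f k < a).card ↔ f i < a := by
  constructor
  · intro h
    by_contra hb
    refine absurd h (not_lt.2 (Finset.card_le_card fun k hk => ?_))
    simp only [Finset.mem_filter, Finset.mem_univ, true_and] at hk ⊢
    linarith
  · intro h
    refine Finset.card_lt_card ((Finset.ssubset_iff_of_subset fun k hk => ?_).2 ⟨i, ?_, ?_⟩)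
    · simp only [Finset.mem_filter, Finset.mem_univ, true_and] at hk ⊢
      linarith
    · simpa using h
    · simp

lemma exists_prefix_thresholds (f : σ → ℝ) {L : ℕ} (hL : Fintype.card σ < 2 ^ L) {a b : ℝ}
    (hab : a ≤ b) : ∃ j k : ℕ, ∀ i,
      ∑ c, (dyadicPrefix L j c - dyadicPrefix L k c) * dyadicPoint L (rankOf f i) c =
        if a ≤ f i ∧ f i ≤ b then 1 else 0 := by
  refine ⟨(Finset.univ.filter fun k => f k ≤ b).card, (Finset.univ.filter fun k => f k < a).card,
    fun i => ?_⟩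
  have hlt : ∀ s : Finset σ, s.card < 2 ^ L := fun s => s.card_le_univ.trans_lt hL
  simp_rw [sub_mul, Finset.sum_sub_distrib]
  have hr : rankOf f i < 2 ^ L := hlt _
  rw [sum_dyadicPrefix_mul_dyadicPoint hr (hlt _), sum_dyadicPrefix_mul_dyadicPoint hr (hlt _)]
  simp only [rankOf_lt_card_le_iff, rankOf_lt_card_lt_iff]
  by_cases h1 : f i ≤ b
  · by_cases h2 : f i < a
    · simp [h1, h2, not_le.2 h2]
    · simp [h1, h2, not_lt.1 h2]
  · have h2 : ¬ f i < a := by linarith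
    simp [h1, h2]

/-- Random rounding which is good for the boxes of finitely many coordinate systems. -/
theorem exists_rounding_boxes [DecidableEq D] [DecidableEq σ] [Nonempty D]
    (f g : D → σ → ℝ) {L : ℕ} (hL : Fintype.card σ < 2 ^ L) (hL0 : 0 < L) {x : σ → ℝ}
    (hx : ∀ i, x i ∈ Set.Icc (0 : ℝ) 1) :
    ∃ w : Finset σ → ℝ, (∀ S, 0 ≤ w S) ∧ ∑ S, w S = 1 ∧
      ∀ (d : D) (a b c e : ℝ), a ≤ b → c ≤ e →
        ∑ S, w S * (∑ i, if (a ≤ f d i ∧ f d i ≤ b) ∧ c ≤ g d i ∧ g d i ≤ e then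
          (if i ∈ S then (1 : ℝ) else 0) - x i else 0) ^ 2 ≤ 16 * Fintype.card D * (L : ℝ) ^ 4 := by
  let I := Fin L × Fin (2 ^ L)
  let v : σ → EuclideanSpace ℝ (D × I × I) := fun i => WithLp.toLp 2 fun z =>
    dyadicPoint L (rankOf (f z.1) i) z.2.1 * dyadicPoint L (rankOf (g z.1) i) z.2.2
  have hD : 0 < (Fintype.card D : ℝ) := by exact_mod_cast Fintype.card_pos
  have hLr : 0 < (L : ℝ) := by exact_mod_cast hL0
  have hv : ∀ i, ‖v i‖ ^ 2 ≤ Fintype.card D * (L : ℝ) ^ 2 := by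
    intro i
    rw [EuclideanSpace.real_norm_sq_eq, Fintype.sum_prod_type]
    calc _ ≤ ∑ _d : D, (L : ℝ) ^ 2 := Finset.sum_le_sum fun d _ => ?_
      _ = _ := by simp
    simp only [v, Fintype.sum_prod_type (α₁ := I), mul_pow]
    rw [← Fintype.sum_mul_sum, sq (L : ℝ)]
    exact mul_le_mul (sum_dyadicPoint_sq_le _ _) (sum_dyadicPoint_sq_le _ _)
      (Finset.sum_nonneg fun _ _ => sq_nonneg _) hLr.le
  obtain ⟨w, w0, w1, -, w3⟩ := hasRounding_of_norm_sq_le (by positivity) hv hx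
  refine ⟨w, w0, w1, fun d a b c e hab hce => ?_⟩
  obtain ⟨j, k, hjk⟩ := exists_prefix_thresholds (f d) hL hab
  obtain ⟨j', k', hjk'⟩ := exists_prefix_thresholds (g d) hL hce
  let θ : EuclideanSpace ℝ (D × I × I) := WithLp.toLp 2 fun z => if z.1 = d then
    (dyadicPrefix L j z.2.1 - dyadicPrefix L k z.2.1) *
      (dyadicPrefix L j' z.2.2 - dyadicPrefix L k' z.2.2) else 0
  have hθ : ‖θ‖ ^ 2 ≤ 16 * (L : ℝ) ^ 2 := by
    rw [EuclideanSpace.real_norm_sq_eq, Fintype.sum_prod_type, Finset.sum_eq_single d]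
    · simp only [θ, if_true, Fintype.sum_prod_type (α₁ := I), mul_pow]
      rw [← Fintype.sum_mul_sum, show 16 * (L : ℝ) ^ 2 = (4 * L) * (4 * L) by ring]
      exact mul_le_mul (sum_dyadicPrefix_sub_sq_le _ _ _) (sum_dyadicPrefix_sub_sq_le _ _ _)
        (Finset.sum_nonneg fun _ _ => sq_nonneg _) (by positivity)
    · intro d' _ hd'
      simp [θ, hd']
    · simp
  have hin : ∀ i, inner ℝ θ (v i) =
      if (a ≤ f d i ∧ f d i ≤ b) ∧ c ≤ g d i ∧ g d i ≤ e then 1 else 0 := by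
    intro i
    rw [euclidean_inner_eq_sum, Fintype.sum_prod_type, Finset.sum_eq_single d]
    · simp only [θ, v, if_true, Fintype.sum_prod_type (α₁ := I)]
      rw [sum_sum_mul_mul_mul, hjk, hjk', ite_and (a ≤ f d i ∧ f d i ≤ b)]
      split_ifs <;> norm_num
    · intro d' _ hd'
      simp [θ, hd']
    · simp
  have herr : ∀ S, inner ℝ θ (roundErr v x S) =
      ∑ i, if (a ≤ f d i ∧ f d i ≤ b) ∧ c ≤ g d i ∧ g d i ≤ e then
        (if i ∈ S then (1 : ℝ) else 0) - x i else 0 := by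
    intro S
    simp only [roundErr, inner_sum, inner_smul_right, hin, mul_ite, mul_one, mul_zero]
  have := w3 θ
  simp_rw [herr] at this
  refine this.trans ?_
  calc _ ≤ (Fintype.card D * (L : ℝ) ^ 2) * (16 * (L : ℝ) ^ 2) := by gcongr
    _ = _ := by ring

end Boxes

section Geometry

/-- The coordinate of `z` along the direction `φ`. -/
def alongCoord (φ : ℝ) (z : ℝ × ℝ) : ℝ := z.1 * Real.cos φ + z.2 * Real.sin φ

/-- The coordinate of `z` perpendicular to the direction `φ`. -/
def acrossCoord (φ : ℝ) (z : ℝ × ℝ) : ℝ := -z.1 * Real.sin φ + z.2 * Real.cos φ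

lemma alongCoord_add_rot (φ : ℝ) (p x : ℝ × ℝ) :
    alongCoord φ (p + rot φ x) = alongCoord φ p + x.1 := by
  simp only [alongCoord, rot, Prod.fst_add, Prod.snd_add]
  linear_combination x.1 * Real.sin_sq_add_cos_sq φ

lemma acrossCoord_add_rot (φ : ℝ) (p x : ℝ × ℝ) :
    acrossCoord φ (p + rot φ x) = acrossCoord φ p + x.2 := by
  simp only [acrossCoord, rot, Prod.fst_add, Prod.snd_add]
  linear_combination x.2 * Real.sin_sq_add_cos_sq φ

lemma add_rot_coords (φ : ℝ) (p z : ℝ × ℝ) :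
    p + rot φ (alongCoord φ z - alongCoord φ p, acrossCoord φ z - acrossCoord φ p) = z := by
  ext
  · simp only [alongCoord, acrossCoord, rot, Prod.fst_add]
    linear_combination (z.1 - p.1) * Real.sin_sq_add_cos_sq φ
  · simp only [alongCoord, acrossCoord, rot, Prod.snd_add]
    linear_combination (z.2 - p.2) * Real.sin_sq_add_cos_sq φ

lemma mem_rect {φ : ℝ} {p z : ℝ × ℝ} {w h : ℝ} : z ∈ rect φ p w h ↔
    (alongCoord φ p ≤ alongCoord φ z ∧ alongCoord φ z ≤ alongCoord φ p + w) ∧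
    acrossCoord φ p ≤ acrossCoord φ z ∧ acrossCoord φ z ≤ acrossCoord φ p + h := by
  constructor
  · rintro ⟨x, ⟨⟨h1, h2⟩, h3, h4⟩, rfl⟩
    simp only [alongCoord_add_rot, acrossCoord_add_rot]
    refine ⟨⟨?_, ?_⟩, ?_, ?_⟩ <;> linarith
  · rintro ⟨⟨h1, h2⟩, h3, h4⟩
    refine ⟨_, ⟨⟨?_, ?_⟩, ?_, ?_⟩, add_rot_coords φ p z⟩ <;> dsimp only <;> linarith

lemma volume_rect (φ : ℝ) (p : ℝ × ℝ) {w : ℝ} (h : ℝ) (hw : 0 ≤ w) :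
    volume (rect φ p w h) = ENNReal.ofReal (w * h) := by
  let T : ℝ × ℝ →ₗ[ℝ] ℝ × ℝ := Matrix.toLin (Module.Basis.finTwoProd ℝ) (Module.Basis.finTwoProd ℝ)
    !![Real.cos φ, -Real.sin φ; Real.sin φ, Real.cos φ]
  have hT : ∀ x, T x = rot φ x := fun x => by
    simp only [T, Matrix.toLin_finTwoProd_apply, rot]
    ext <;> simp <;> ring
  have hdet : LinearMap.det T = 1 := by
    simp only [T, LinearMap.det_toLin, Matrix.det_fin_two_of]
    linear_combination Real.sin_sq_add_cos_sq φ
  have hrect : rect φ p w h = (fun y => p + y) '' (T '' (Set.Icc 0 w ×ˢ Set.Icc 0 h)) := by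
    rw [Set.image_image]
    simp only [hT, rect]
  rw [hrect, Set.image_add_left, measure_preimage_add, Measure.addHaar_image_linearMap, hdet,
    Measure.volume_eq_prod, Measure.prod_prod, Real.volume_Icc, Real.volume_Icc,
    ENNReal.ofReal_mul hw]
  simp

lemma abs_mul_add_mul_le {a b c s ε : ℝ} (ha : |a| ≤ ε) (hb : |b| ≤ ε) (hc : |c| ≤ 1)
    (hs : |s| ≤ 1) : |a * c + b * s| ≤ 2 * ε := by
  have h1 : |a * c| ≤ ε * 1 := by rw [abs_mul]; gcongr; exact (abs_nonneg a).trans ha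
  have h2 : |b * s| ≤ ε * 1 := by rw [abs_mul]; gcongr; exact (abs_nonneg b).trans hb
  linarith [abs_add_le (a * c) (b * s)]

lemma mem_rect_expand {φ w h ε : ℝ} {p z y : ℝ × ℝ} (hz : z ∈ rect φ p w h)
    (h1 : |y.1 - z.1| ≤ ε) (h2 : |y.2 - z.2| ≤ ε) :
    y ∈ rect φ (p + rot φ (-(2 * ε), -(2 * ε))) (w + 4 * ε) (h + 4 * ε) := by
  rw [mem_rect] at hz ⊢
  simp only [alongCoord_add_rot, acrossCoord_add_rot]
  have a1 := abs_le.1 (abs_mul_add_mul_le h1 h2 (Real.abs_cos_le_one φ) (Real.abs_sin_le_one φ))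
  have a2 := abs_le.1 (abs_mul_add_mul_le h2 h1 (Real.abs_cos_le_one φ)
    (show |-Real.sin φ| ≤ 1 by rw [abs_neg]; exact Real.abs_sin_le_one φ))
  have e1 : alongCoord φ y = alongCoord φ z +
      ((y.1 - z.1) * Real.cos φ + (y.2 - z.2) * Real.sin φ) := by
    simp only [alongCoord]; ring
  have e2 : acrossCoord φ y = acrossCoord φ z +
      ((y.2 - z.2) * Real.cos φ + (y.1 - z.1) * -Real.sin φ) := by
    simp only [acrossCoord]; ring
  obtain ⟨⟨b1, b2⟩, b3, b4⟩ := hz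
  refine ⟨⟨?_, ?_⟩, ?_, ?_⟩ <;> linarith

/-- The points of the `N × N` grid. -/
def gridPt (N : ℕ) (i : Fin N × Fin N) : ℝ × ℝ := ((i.1 : ℝ) / N, (i.2 : ℝ) / N)

/-- The cells of the `N × N` grid. -/
def gridCell (N : ℕ) (i : Fin N × Fin N) : Set (ℝ × ℝ) :=
  Set.Ico ((i.1 : ℝ) / N) (((i.1 : ℝ) + 1) / N) ×ˢ Set.Ico ((i.2 : ℝ) / N) (((i.2 : ℝ) + 1) / N)

lemma gridPt_injective {N : ℕ} (hN : 0 < N) : Function.Injective (gridPt N) := by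
  intro i j h
  have hN' : (N : ℝ) ≠ 0 := by positivity
  simp only [gridPt, Prod.mk.injEq, div_left_inj' hN', Nat.cast_inj] at h
  exact Prod.ext (Fin.ext h.1) (Fin.ext h.2)

lemma gridPt_mem_unitSq {N : ℕ} (i : Fin N × Fin N) : gridPt N i ∈ unitSq := by
  have h : ∀ k : Fin N, (k : ℝ) / N ∈ Set.Icc (0 : ℝ) 1 := fun k =>
    ⟨by positivity, div_le_one_of_le₀ (by exact_mod_cast k.2.le) (by positivity)⟩
  exact ⟨h _, h _⟩

lemma volume_gridCell (N : ℕ) (i : Fin N × Fin N) :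
    volume (gridCell N i) = ENNReal.ofReal ((1 / N) * (1 / N)) := by
  rw [gridCell, Measure.volume_eq_prod, Measure.prod_prod, Real.volume_Ico, Real.volume_Ico,
    ENNReal.ofReal_mul (by positivity)]
  congr 2 <;> ring

lemma dist_gridPt_of_mem_gridCell {N : ℕ} {i : Fin N × Fin N} {z : ℝ × ℝ} (hz : z ∈ gridCell N i) :
    |(gridPt N i).1 - z.1| ≤ 1 / N ∧ |(gridPt N i).2 - z.2| ≤ 1 / N := by
  obtain ⟨⟨h1, h2⟩, h3, h4⟩ := hz
  rw [add_div] at h2 h4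
  simp only [gridPt, abs_le]
  have : (0 : ℝ) ≤ 1 / N := by positivity
  refine ⟨⟨?_, ?_⟩, ?_, ?_⟩ <;> linarith

lemma floor_eq_of_mem_Ico {N k : ℕ} (hN : 0 < N) {x : ℝ}
    (hx : x ∈ Set.Ico ((k : ℝ) / N) (((k : ℝ) + 1) / N)) : ⌊N * x⌋₊ = k := by
  have hN' : (0 : ℝ) < N := by exact_mod_cast hN
  have h1 := (div_le_iff₀ hN').1 hx.1
  have h2 := (lt_div_iff₀ hN').1 hx.2
  rw [Nat.floor_eq_iff (by rw [mul_comm]; exact le_trans (by positivity) h1)]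
  constructor <;> linarith

lemma mem_Ico_floor {N : ℕ} (hN : 0 < N) {x : ℝ} (hx : 0 ≤ x) :
    x ∈ Set.Ico ((⌊N * x⌋₊ : ℝ) / N) (((⌊N * x⌋₊ : ℝ) + 1) / N) := by
  have hN' : (0 : ℝ) < N := by exact_mod_cast hN
  have h1 := Nat.floor_le (a := N * x) (by positivity)
  have h2 := Nat.lt_floor_add_one (N * x)
  constructor
  · rw [div_le_iff₀ hN']; linarith
  · rw [lt_div_iff₀ hN']; linarith

lemma gridCell_disjoint {N : ℕ} (hN : 0 < N) {i j : Fin N × Fin N} (h : i ≠ j) :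
    Disjoint (gridCell N i) (gridCell N j) := by
  rw [Set.disjoint_left]
  intro z hi hj
  refine h (Prod.ext (Fin.ext ?_) (Fin.ext ?_))
  · rw [← floor_eq_of_mem_Ico hN hi.1, floor_eq_of_mem_Ico hN hj.1]
  · rw [← floor_eq_of_mem_Ico hN hi.2, floor_eq_of_mem_Ico hN hj.2]

open Classical in
/-- The indices in `S` whose grid points lie in the set `R`. -/
def gridIn {N : ℕ} (S : Finset (Fin N × Fin N)) (R : Set (ℝ × ℝ)) : Finset (Fin N × Fin N) :=
  S.filter fun i => gridPt N i ∈ R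

lemma mem_gridIn {N : ℕ} {S : Finset (Fin N × Fin N)} {R : Set (ℝ × ℝ)} {i : Fin N × Fin N} :
    i ∈ gridIn S R ↔ i ∈ S ∧ gridPt N i ∈ R := by
  simp [gridIn]

lemma volume_biUnion_gridCell {N : ℕ} (hN : 0 < N) (S : Finset (Fin N × Fin N)) :
    volume (⋃ i ∈ S, gridCell N i) = ENNReal.ofReal (S.card * ((1 / N) * (1 / N))) := by
  rw [measure_biUnion_finset (fun i _ j _ h => gridCell_disjoint hN h)
    (fun i _ => measurableSet_Ico.prod measurableSet_Ico)]
  simp only [volume_gridCell, Finset.sum_const, nsmul_eq_mul]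
  rw [ENNReal.ofReal_mul (p := (S.card : ℝ)) (by positivity), ENNReal.ofReal_natCast]

lemma gridIn_card_le {N : ℕ} (hN : 0 < N) (φ : ℝ) (p : ℝ × ℝ) {w h : ℝ} (hw : w ∈ Set.Icc (0 : ℝ) 1)
    (hh : h ∈ Set.Icc (0 : ℝ) 1) :
    ((gridIn (Finset.univ : Finset (Fin N × Fin N)) (rect φ p w h)).card : ℝ) ≤
      N ^ 2 * (w * h) + 24 * N := by
  have hN' : (1 : ℝ) ≤ N := by exact_mod_cast hN
  have hsub : (⋃ i ∈ gridIn (Finset.univ : Finset (Fin N × Fin N)) (rect φ p w h), gridCell N i) ⊆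
      rect φ (p + rot φ (-(2 * (1 / N)), -(2 * (1 / N)))) (w + 4 * (1 / N)) (h + 4 * (1 / N)) := by
    simp only [Set.iUnion_subset_iff]
    intro i hi z hz
    obtain ⟨h1, h2⟩ := dist_gridPt_of_mem_gridCell hz
    exact mem_rect_expand (mem_gridIn.1 hi).2 (by rwa [abs_sub_comm]) (by rwa [abs_sub_comm])
  have hε : (0 : ℝ) < 1 / N := by positivity
  have hle := measure_mono (μ := volume) hsub
  rw [volume_biUnion_gridCell hN, volume_rect _ _ _ (by linarith [hw.1]),
    ENNReal.ofReal_le_ofReal_iff (by have := hw.1; have := hh.1; positivity)] at hle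
  have hc : ∀ c : ℝ, c = N ^ 2 * (c * ((1 / N) * (1 / N))) := fun c => by field_simp
  rw [hc ((gridIn (Finset.univ : Finset (Fin N × Fin N)) (rect φ p w h)).card : ℝ)]
  calc _ ≤ (N : ℝ) ^ 2 * ((w + 4 * (1 / N)) * (h + 4 * (1 / N))) := by gcongr
    _ = N ^ 2 * (w * h) + 4 * N * (w + h) + 16 := by field_simp; ring
    _ ≤ _ := by nlinarith [hw.2, hh.2]

lemma le_gridIn_card {N : ℕ} (hN : 0 < N) {φ : ℝ} {p : ℝ × ℝ} {w h : ℝ}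
    (hw : w ∈ Set.Icc (0 : ℝ) 1) (hh : h ∈ Set.Icc (0 : ℝ) 1) (hR : rect φ p w h ⊆ unitSq) :
    N ^ 2 * (w * h) - 24 * N ≤
      ((gridIn (Finset.univ : Finset (Fin N × Fin N)) (rect φ p w h)).card : ℝ) := by
  have hN' : (1 : ℝ) ≤ N := by exact_mod_cast hN
  have hε : (0 : ℝ) < 1 / N := by positivity
  have hNε : (N : ℝ) * (1 / N) = 1 := by field_simp
  set c := ((gridIn (Finset.univ : Finset (Fin N × Fin N)) (rect φ p w h)).card : ℝ) with hcdef
  have hc0 : 0 ≤ c := by positivity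
  have hsmall : w * h ≤ 4 * (1 / N) → N ^ 2 * (w * h) - 24 * N ≤ c := fun hle => by
    have h2 : (N : ℝ) ^ 2 * (w * h) ≤ N ^ 2 * (4 * (1 / N)) := by gcongr
    have h3 : (N : ℝ) ^ 2 * (4 * (1 / N)) = 4 * N := by field_simp
    linarith
  by_cases hw4 : w < 4 * (1 / N)
  · exact hsmall (by nlinarith [hw.1, hh.1, hh.2])
  by_cases hh4 : h < 4 * (1 / N)
  · exact hsmall (by nlinarith [hw.1, hh.1, hw.2])
  push Not at hw4 hh4
  have hexp : ∀ z ∈ rect φ (p + rot φ (2 * (1 / N), 2 * (1 / N))) (w - 4 * (1 / N))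
      (h - 4 * (1 / N)), ∀ y : ℝ × ℝ, |y.1 - z.1| ≤ 1 / N → |y.2 - z.2| ≤ 1 / N →
      y ∈ rect φ p w h := by
    intro z hz y h1 h2
    have := mem_rect_expand hz h1 h2
    rw [mem_rect] at this ⊢
    simp only [alongCoord_add_rot, acrossCoord_add_rot] at this
    obtain ⟨⟨b1, b2⟩, b3, b4⟩ := this
    refine ⟨⟨?_, ?_⟩, ?_, ?_⟩ <;> linarith
  have hsub : rect φ (p + rot φ (2 * (1 / N), 2 * (1 / N))) (w - 4 * (1 / N)) (h - 4 * (1 / N)) ⊆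
      ⋃ i ∈ gridIn (Finset.univ : Finset (Fin N × Fin N)) (rect φ p w h), gridCell N i := by
    intro z hz
    have hz0 := hR (hexp z hz z (by simp) (by simp))
    have hz1 := hR (hexp z hz (z.1 + 1 / N, z.2 + 1 / N) (by simp) (by simp))
    have hlt : ∀ x : ℝ, 0 ≤ x → x + 1 / N ≤ 1 → ⌊N * x⌋₊ < N := fun x h0 h1 => by
      rw [Nat.floor_lt (by positivity)]
      nlinarith
    have m1 := mem_Ico_floor hN hz0.1.1
    have m2 := mem_Ico_floor hN hz0.2.1
    let i : Fin N × Fin N := (⟨_, hlt _ hz0.1.1 hz1.1.2⟩, ⟨_, hlt _ hz0.2.1 hz1.2.2⟩)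
    have hmem : z ∈ gridCell N i := ⟨m1, m2⟩
    obtain ⟨d1, d2⟩ := dist_gridPt_of_mem_gridCell hmem
    exact Set.mem_biUnion (mem_gridIn.2 ⟨Finset.mem_univ i, hexp z hz _ d1 d2⟩) hmem
  have hle := measure_mono (μ := volume) hsub
  rw [volume_biUnion_gridCell hN, volume_rect _ _ _ (by linarith),
    ENNReal.ofReal_le_ofReal_iff (by positivity), ← hcdef] at hle
  have hc : ∀ c : ℝ, c = N ^ 2 * (c * ((1 / N) * (1 / N))) := fun c => by field_simp
  rw [hc c]
  calc N ^ 2 * (w * h) - 24 * N ≤ N ^ 2 * (w * h) - 4 * N * (w + h) + 16 := by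
        nlinarith [hw.2, hh.2]
    _ = (N : ℝ) ^ 2 * ((w - 4 * (1 / N)) * (h - 4 * (1 / N))) := by field_simp; ring
    _ ≤ _ := by gcongr

/-- The discrepancy of the grid points indexed by `S` in a rectangle. -/
def gridDisc {N : ℕ} (S : Finset (Fin N × Fin N)) (φ : ℝ) (p : ℝ × ℝ) (w h : ℝ) : ℝ :=
  (gridIn S (rect φ p w h)).card - N * (w * h)

lemma sum_ite_indicator_sub {σ : Type*} [Fintype σ] [DecidableEq σ] (Q : σ → Prop) [DecidablePred Q]
    (S : Finset σ) (c : ℝ) :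
    (∑ i, if Q i then (if i ∈ S then (1 : ℝ) else 0) - c else 0) =
      (S.filter Q).card - (Finset.univ.filter Q).card * c := by
  rw [← Finset.sum_filter, Finset.sum_sub_distrib, Finset.sum_boole, Finset.sum_const, nsmul_eq_mul,
    Finset.filter_filter]
  congr 3
  ext i
  simp [and_comm]

lemma exists_random_grid_subset {D : Type*} [Fintype D] [DecidableEq D] [Nonempty D] (ang : D → ℝ)
    {N L : ℕ} (hN : 0 < N) (hL : N ^ 2 < 2 ^ L) (hL0 : 0 < L) :
    ∃ ν : Finset (Fin N × Fin N) → ℝ, (∀ S, 0 ≤ ν S) ∧ ∑ S, ν S = 1 ∧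
      ∀ (d : D) (p : ℝ × ℝ) (w h : ℝ), w ∈ Set.Icc (0 : ℝ) 1 → h ∈ Set.Icc (0 : ℝ) 1 →
        rect (ang d) p w h ⊆ unitSq →
        ∑ S, ν S * gridDisc S (ang d) p w h ^ 2 ≤ 32 * Fintype.card D * (L : ℝ) ^ 4 + 1152 := by
  have hN' : (1 : ℝ) ≤ N := by exact_mod_cast hN
  obtain ⟨ν, n0, n1, n2⟩ := exists_rounding_boxes
    (fun d (i : Fin N × Fin N) => alongCoord (ang d) (gridPt N i))
    (fun d i => acrossCoord (ang d) (gridPt N i)) (L := L)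
    (by simpa [← sq] using hL) hL0 (x := fun _ => 1 / (N : ℝ))
    (fun _ => ⟨by positivity, div_le_one_of_le₀ hN' (by positivity)⟩)
  refine ⟨ν, n0, n1, fun d p w h hw hh hR => ?_⟩
  have key := n2 d (alongCoord (ang d) p) (alongCoord (ang d) p + w) (acrossCoord (ang d) p)
    (acrossCoord (ang d) p + h) (by linarith [hw.1]) (by linarith [hh.1])
  have hgridIn : ∀ S : Finset (Fin N × Fin N), gridIn S (rect (ang d) p w h) = S.filter fun i =>
      (alongCoord (ang d) p ≤ alongCoord (ang d) (gridPt N i) ∧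
        alongCoord (ang d) (gridPt N i) ≤ alongCoord (ang d) p + w) ∧
      acrossCoord (ang d) p ≤ acrossCoord (ang d) (gridPt N i) ∧
        acrossCoord (ang d) (gridPt N i) ≤ acrossCoord (ang d) p + h := fun S => by
    ext i
    rw [mem_gridIn, mem_rect, Finset.mem_filter]
  simp_rw [sum_ite_indicator_sub, ← hgridIn] at key
  have hgrid : |((gridIn (Finset.univ : Finset (Fin N × Fin N)) (rect (ang d) p w h)).card : ℝ) *
      (1 / N) - N * (w * h)| ≤ 24 := by
    have h1 := gridIn_card_le hN (ang d) p hw hh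
    have h2 := le_gridIn_card hN hw hh hR
    rw [mul_one_div, abs_le]
    constructor
    · rw [le_sub_iff_add_le, le_div_iff₀ (by linarith)]
      linarith
    · rw [sub_le_iff_le_add, div_le_iff₀ (by linarith)]
      linarith
  generalize ((gridIn (Finset.univ : Finset (Fin N × Fin N)) (rect (ang d) p w h)).card : ℝ) *
      (1 / N) = c at *
  have hg2 : (c - N * (w * h)) ^ 2 ≤ 576 := by
    have := sq_le_sq' (abs_le.1 hgrid).1 (abs_le.1 hgrid).2
    linarith
  calc ∑ S, ν S * gridDisc S (ang d) p w h ^ 2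
      ≤ ∑ S, (2 * (ν S * (((gridIn S (rect (ang d) p w h)).card : ℝ) - c) ^ 2) + ν S * 1152) := by
        refine Finset.sum_le_sum fun S _ => ?_
        rw [mul_left_comm, ← mul_add]
        refine mul_le_mul_of_nonneg_left ?_ (n0 S)
        unfold gridDisc
        nlinarith [sq_nonneg (((gridIn S (rect (ang d) p w h)).card : ℝ) - c - (c - N * (w * h)))]
    _ ≤ _ := by
      rw [Finset.sum_add_distrib, ← Finset.mul_sum, ← Finset.sum_mul, n1]
      linarith

end Geometry

section SmallAngle

lemma mem_rect_zero {p z : ℝ × ℝ} {w h : ℝ} : z ∈ rect 0 p w h ↔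
    (p.1 ≤ z.1 ∧ z.1 ≤ p.1 + w) ∧ p.2 ≤ z.2 ∧ z.2 ≤ p.2 + h := by
  simp [mem_rect, alongCoord, acrossCoord]

lemma gridIn_card_mono {N : ℕ} (S : Finset (Fin N × Fin N)) {R R' : Set (ℝ × ℝ)} (h : R ⊆ R') :
    ((gridIn S R).card : ℝ) ≤ (gridIn S R').card := by
  exact_mod_cast Finset.card_le_card fun i hi =>
    mem_gridIn.2 ⟨(mem_gridIn.1 hi).1, h (mem_gridIn.1 hi).2⟩

/-- A rectangle in a direction close to horizontal has an axis-parallel bounding box of almost the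
same area. -/
lemma exists_outer_box {φ : ℝ} (hc : 0 ≤ Real.cos φ) (hs : 0 ≤ Real.sin φ) {p : ℝ × ℝ} {w h : ℝ}
    (hw : w ∈ Set.Icc (0 : ℝ) 1) (hh : h ∈ Set.Icc (0 : ℝ) 1) (hR : rect φ p w h ⊆ unitSq) :
    ∃ (q : ℝ × ℝ) (w' h' : ℝ), w' ∈ Set.Icc (0 : ℝ) 1 ∧ h' ∈ Set.Icc (0 : ℝ) 1 ∧
      rect 0 q w' h' ⊆ unitSq ∧ rect φ p w h ⊆ rect 0 q w' h' ∧
      w' * h' ≤ w * h + 2 * Real.sin φ := by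
  have hcorner : ∀ a b : ℝ, a ∈ Set.Icc 0 w → b ∈ Set.Icc 0 h → p + rot φ (a, b) ∈ unitSq :=
    fun a b ha hb => hR ⟨(a, b), ⟨ha, hb⟩, rfl⟩
  have k1 := hcorner 0 h ⟨le_rfl, hw.1⟩ ⟨hh.1, le_rfl⟩
  have k2 := hcorner w 0 ⟨hw.1, le_rfl⟩ ⟨le_rfl, hh.1⟩
  have k3 := hcorner 0 0 ⟨le_rfl, hw.1⟩ ⟨le_rfl, hh.1⟩
  have k4 := hcorner w h ⟨hw.1, le_rfl⟩ ⟨hh.1, le_rfl⟩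
  have hc1 := Real.cos_le_one φ
  have hsc := Real.sin_sq_add_cos_sq φ
  have hws := mul_nonneg hw.1 hs
  have hwc := mul_nonneg hw.1 hc
  have hhs := mul_nonneg hh.1 hs
  have hhc := mul_nonneg hh.1 hc
  simp only [unitSq, rot, Set.mem_prod, Set.mem_Icc, Prod.fst_add, Prod.snd_add, zero_mul,
    zero_sub, zero_add, sub_zero, add_zero] at k1 k2 k3 k4
  refine ⟨(p.1 - h * Real.sin φ, p.2), w * Real.cos φ + h * Real.sin φ,
    w * Real.sin φ + h * Real.cos φ, ⟨by positivity, by linarith⟩, ⟨by positivity, by linarith⟩,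
    ?_, ?_, ?_⟩
  · intro z hz
    rw [mem_rect_zero] at hz
    dsimp only at hz
    exact ⟨⟨by linarith, by linarith⟩, by linarith, by linarith⟩
  · rintro _ ⟨⟨a, b⟩, ⟨⟨a0, a1⟩, b0, b1⟩, rfl⟩
    dsimp only at a0 a1 b0 b1
    rw [mem_rect_zero]
    simp only [rot, Prod.fst_add, Prod.snd_add]
    have := mul_nonneg a0 hc
    have := mul_nonneg a0 hs
    have := mul_nonneg b0 hc
    have := mul_nonneg b0 hs
    have := mul_le_mul_of_nonneg_right a1 hc
    have := mul_le_mul_of_nonneg_right a1 hs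
    have := mul_le_mul_of_nonneg_right b1 hc
    have := mul_le_mul_of_nonneg_right b1 hs
    refine ⟨⟨?_, ?_⟩, ?_, ?_⟩ <;> linarith
  · have e : (w * Real.cos φ + h * Real.sin φ) * (w * Real.sin φ + h * Real.cos φ) =
        w * h + Real.cos φ * Real.sin φ * (w ^ 2 + h ^ 2) := by
      linear_combination (w * h) * hsc
    have h1 : w ^ 2 + h ^ 2 ≤ 2 := by nlinarith [hw.1, hw.2, hh.1, hh.2]
    have h2 : Real.cos φ * Real.sin φ ≤ Real.sin φ := mul_le_of_le_one_left hs hc1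
    rw [e]
    nlinarith [mul_nonneg hc hs]

/-- A rectangle in a direction close to horizontal contains an axis-parallel box of almost the
same area, unless its area is negligible. -/
lemma exists_inner_box {φ : ℝ} (hc : 0 ≤ Real.cos φ) (hs : 0 ≤ Real.sin φ) (p : ℝ × ℝ) {w h : ℝ}
    (hw : w ∈ Set.Icc (0 : ℝ) 1) (hh : h ∈ Set.Icc (0 : ℝ) 1) :
    w * h ≤ 2 * Real.sin φ ∨
    ∃ (q : ℝ × ℝ) (w' h' : ℝ), w' ∈ Set.Icc (0 : ℝ) 1 ∧ h' ∈ Set.Icc (0 : ℝ) 1 ∧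
      rect 0 q w' h' ⊆ rect φ p w h ∧ w * h ≤ w' * h' + 2 * Real.sin φ := by
  have hc1 := Real.cos_le_one φ
  have hs1 := Real.sin_le_one φ
  have hsc := Real.sin_sq_add_cos_sq φ
  have hws := mul_nonneg hw.1 hs
  have hwc := mul_nonneg hw.1 hc
  have hhs := mul_nonneg hh.1 hs
  have hhc := mul_nonneg hh.1 hc
  have hwc1 : w * Real.cos φ ≤ 1 := mul_le_one₀ hw.2 hc hc1
  have hhc1 : h * Real.cos φ ≤ 1 := mul_le_one₀ hh.2 hc hc1
  have hws1 : w * Real.sin φ ≤ Real.sin φ := mul_le_of_le_one_left hs hw.2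
  have hhs1 : h * Real.sin φ ≤ Real.sin φ := mul_le_of_le_one_left hs hh.2
  have e0 : w * h = (w * Real.cos φ) * (h * Real.cos φ) + (w * Real.sin φ) * (h * Real.sin φ) := by
    linear_combination -(w * h) * hsc
  by_cases h1 : w * Real.cos φ < h * Real.sin φ
  · left
    nlinarith
  by_cases h2 : h * Real.cos φ < w * Real.sin φ
  · left
    nlinarith
  push Not at h1 h2
  refine Or.inr ⟨(p.1, p.2 + w * Real.sin φ), w * Real.cos φ - h * Real.sin φ,
    h * Real.cos φ - w * Real.sin φ, ⟨by linarith, by linarith⟩, ⟨by linarith, by linarith⟩, ?_, ?_⟩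
  · intro z hz
    rw [mem_rect_zero] at hz
    dsimp only at hz
    obtain ⟨⟨b1, b2⟩, b3, b4⟩ := hz
    rw [mem_rect]
    simp only [alongCoord, acrossCoord]
    have := mul_le_mul_of_nonneg_right b1 hc
    have := mul_le_mul_of_nonneg_right b1 hs
    have := mul_le_mul_of_nonneg_right b2 hc
    have := mul_le_mul_of_nonneg_right b2 hs
    have := mul_le_mul_of_nonneg_right b3 hc
    have := mul_le_mul_of_nonneg_right b3 hs
    have := mul_le_mul_of_nonneg_right b4 hc
    have := mul_le_mul_of_nonneg_right b4 hs
    have := mul_nonneg hws hs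
    have := mul_nonneg hhs hs
    have e1 : w = w * Real.cos φ * Real.cos φ + w * Real.sin φ * Real.sin φ := by
      linear_combination -w * hsc
    have e2 : h = h * Real.cos φ * Real.cos φ + h * Real.sin φ * Real.sin φ := by
      linear_combination -h * hsc
    refine ⟨⟨?_, ?_⟩, ?_, ?_⟩ <;> nlinarith
  · have e : (w * Real.cos φ - h * Real.sin φ) * (h * Real.cos φ - w * Real.sin φ) =
        w * h - Real.cos φ * Real.sin φ * (w ^ 2 + h ^ 2) := by
      linear_combination (w * h) * hsc
    have h1 : w ^ 2 + h ^ 2 ≤ 2 := by nlinarith [hw.1, hw.2, hh.1, hh.2]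
    have h2 : Real.cos φ * Real.sin φ ≤ Real.sin φ := mul_le_of_le_one_left hs hc1
    rw [e]
    nlinarith [mul_nonneg hc hs]

lemma exists_boxes_gridDisc_le {N : ℕ} {φ : ℝ} (hc : 0 ≤ Real.cos φ) (hs : 0 ≤ Real.sin φ)
    (hsN : N * Real.sin φ ≤ 1) {p : ℝ × ℝ} {w h : ℝ}
    (hw : w ∈ Set.Icc (0 : ℝ) 1) (hh : h ∈ Set.Icc (0 : ℝ) 1) (hR : rect φ p w h ⊆ unitSq) :
    ∃ (q : ℝ × ℝ) (a b : ℝ) (q' : ℝ × ℝ) (a' b' : ℝ),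
      (a ∈ Set.Icc (0 : ℝ) 1 ∧ b ∈ Set.Icc (0 : ℝ) 1 ∧ rect 0 q a b ⊆ unitSq) ∧
      (a' ∈ Set.Icc (0 : ℝ) 1 ∧ b' ∈ Set.Icc (0 : ℝ) 1 ∧ rect 0 q' a' b' ⊆ unitSq) ∧
      ∀ S : Finset (Fin N × Fin N),
        |gridDisc S φ p w h| ≤ |gridDisc S 0 q a b| + |gridDisc S 0 q' a' b'| + 2 := by
  obtain ⟨q, a, b, ha, hb, hq, hsub, harea⟩ := exists_outer_box hc hs hw hh hR
  have hNr : (0 : ℝ) ≤ N := by positivity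
  have hup : ∀ S : Finset (Fin N × Fin N), gridDisc S φ p w h ≤ |gridDisc S 0 q a b| + 2 := by
    intro S
    have h1 := gridIn_card_mono S hsub
    have h2 := le_abs_self (gridDisc S 0 q a b)
    have h3 := mul_le_mul_of_nonneg_left harea hNr
    unfold gridDisc at h2 ⊢
    linarith
  rcases exists_inner_box hc hs p hw hh with hsmall | ⟨q', a', b', ha', hb', hsub', harea'⟩
  · refine ⟨q, a, b, q, a, b, ⟨ha, hb, hq⟩, ⟨ha, hb, hq⟩, fun S => abs_le.2 ⟨?_, ?_⟩⟩
    · have h3 := mul_le_mul_of_nonneg_left hsmall hNr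
      have h4 := abs_nonneg (gridDisc S 0 q a b)
      have h5 : (0 : ℝ) ≤ (gridIn S (rect φ p w h)).card := by positivity
      rw [show gridDisc S φ p w h = (gridIn S (rect φ p w h)).card - N * (w * h) from rfl]
      linarith
    · linarith [hup S, abs_nonneg (gridDisc S 0 q a b)]
  · refine ⟨q, a, b, q', a', b', ⟨ha, hb, hq⟩, ⟨ha', hb', hsub'.trans hR⟩,
      fun S => abs_le.2 ⟨?_, ?_⟩⟩
    · have h1 := gridIn_card_mono S hsub'
      have h2 := neg_abs_le (gridDisc S 0 q' a' b')
      have h3 := mul_le_mul_of_nonneg_left harea' hNr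
      have h4 := abs_nonneg (gridDisc S 0 q a b)
      rw [show gridDisc S φ p w h = (gridIn S (rect φ p w h)).card - N * (w * h) from rfl]
      rw [show gridDisc S 0 q' a' b' = (gridIn S (rect 0 q' a' b')).card - N * (a' * b') from rfl]
        at h2 ⊢
      linarith
    · linarith [hup S, abs_nonneg (gridDisc S 0 q' a' b')]

end SmallAngle

section Assembly

lemma exists_card_eq_gridIn_close {N : ℕ} (S : Finset (Fin N × Fin N)) :
    ∃ S' : Finset (Fin N × Fin N), S'.card = N ∧ ∀ R,
      |((gridIn S' R).card : ℝ) - (gridIn S R).card| ≤ |(S.card : ℝ) - N| := by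
  have aux : ∀ U V : Finset (Fin N × Fin N), U ⊆ V → ∀ R,
      |((gridIn V R).card : ℝ) - (gridIn U R).card| ≤ |(V.card : ℝ) - U.card| := by
    intro U V hUV R
    have h1 : gridIn U R ⊆ gridIn V R := fun i hi =>
      mem_gridIn.2 ⟨hUV (mem_gridIn.1 hi).1, (mem_gridIn.1 hi).2⟩
    have h2 : gridIn V R \ gridIn U R ⊆ V \ U := fun i hi => by
      simp only [Finset.mem_sdiff, mem_gridIn] at hi ⊢
      tauto
    have h3 := Finset.card_le_card h2
    have h4 := Finset.card_sdiff_add_card_eq_card h1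
    have h5 := Finset.card_sdiff_add_card_eq_card hUV
    rw [← h4, ← h5]
    push_cast
    rw [add_sub_cancel_right, add_sub_cancel_right, Nat.abs_cast, Nat.abs_cast]
    exact_mod_cast h3
  rcases le_total N S.card with h | h
  · obtain ⟨S', hS', hcard⟩ := Finset.exists_subset_card_eq h
    refine ⟨S', hcard, fun R => ?_⟩
    rw [abs_sub_comm]
    have := aux S' S hS' R
    rwa [hcard] at this
  · obtain ⟨S', hS', hcard⟩ := Finset.exists_superset_card_eq h (by
      simp only [Fintype.card_prod, Fintype.card_fin]; nlinarith [Nat.zero_le N])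
    refine ⟨S', hcard, fun R => ?_⟩
    have := aux S S' hS' R
    rwa [hcard, abs_sub_comm (N : ℝ)] at this


lemma exists_le_of_weighted_sum_le {ι : Type*} [Fintype ι] {ν f : ι → ℝ} {b : ℝ}
    (hν : ∀ i, 0 ≤ ν i) (hν1 : ∑ i, ν i = 1) (h : ∑ i, ν i * f i ≤ b) : ∃ i, f i ≤ b := by
  by_contra! hf
  have h1 : ∑ i, ν i * (f i - b) ≤ 0 := by
    simp only [mul_sub, Finset.sum_sub_distrib, ← Finset.sum_mul, hν1]
    linarith
  have h2 : ∀ i ∈ Finset.univ, 0 ≤ ν i * (f i - b) := fun i _ =>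
    mul_nonneg (hν i) (sub_nonneg.2 (hf i).le)
  have h3 := (Finset.sum_eq_zero_iff_of_nonneg h2).1 (le_antisymm h1 (Finset.sum_nonneg h2))
  have h4 : ∀ i, ν i = 0 := fun i =>
    (mul_eq_zero.1 (h3 i (Finset.mem_univ i))).resolve_right (sub_pos.2 (hf i)).ne'
  simp [h4] at hν1

/-- If a random function is bounded on average at every point, one of its values has small integral.
No measurability is needed, since the integral of a non-integrable function is zero. -/
lemma exists_integral_le_of_weighted_sum_le {ι T : Type*} [Fintype ι] [MeasurableSpace T]
    (μ : Measure T) [IsProbabilityMeasure μ] {ν : ι → ℝ} {g : ι → T → ℝ} {b : ℝ} (hb : 0 ≤ b)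
    (hν : ∀ i, 0 ≤ ν i) (hν1 : ∑ i, ν i = 1) (h : ∀ t, ∑ i, ν i * g i t ≤ b) :
    ∃ i, ∫ t, g i t ∂μ ≤ b := by
  by_cases hg : ∀ i, Integrable (g i) μ
  · refine exists_le_of_weighted_sum_le hν hν1 ?_
    have hg' : ∀ i ∈ Finset.univ, Integrable (fun t => ν i * g i t) μ := fun i _ =>
      (hg i).const_mul _
    simp only [← integral_const_mul]
    rw [← integral_finsetSum _ hg']
    calc ∫ t, ∑ i, ν i * g i t ∂μ ≤ ∫ _, b ∂μ :=
          integral_mono (integrable_finsetSum _ hg') (integrable_const b) h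
      _ = b := by simp
  · push Not at hg
    obtain ⟨i, hi⟩ := hg
    exact ⟨i, (integral_undef hi).trans_le hb⟩

lemma one_le_plog (N : ℕ) : 1 ≤ plog N := le_max_left _ _

/-- Only logarithmically many terms of a lacunary sequence of angles exceed `1 / N`. -/
lemma exists_lacunary_cutoff {θ : ℕ → ℝ} {A : ℝ} (hA0 : 0 < A) (hA1 : A < 1)
    (hθ : ∀ n, θ n ∈ Set.Ioc 0 (Real.pi / 2)) (hlac : ∀ n, θ (n + 1) ≤ A * θ n) :
    ∃ K : ℝ, 0 < K ∧ ∀ N : ℕ, 2 ≤ N → ∃ m : ℕ, (m : ℝ) + 1 ≤ K * plog N ∧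
      ∀ n, m ≤ n → N * Real.sin (θ n) ≤ 1 := by
  have hc : 0 < -Real.log A := neg_pos.2 (Real.log_neg hA0 hA1)
  set c := -Real.log A with hcdef
  have hpow : ∀ n, θ n ≤ A ^ n * 2 := by
    intro n
    induction n with
    | zero => simpa using (hθ 0).2.trans (by linarith [Real.pi_le_four])
    | succ n ih =>
      calc θ (n + 1) ≤ A * θ n := hlac n
        _ ≤ A * (A ^ n * 2) := by gcongr
        _ = A ^ (n + 1) * 2 := by ring
  refine ⟨2 / c + 2, by positivity, fun N hN => ?_⟩
  have hN' : (2 : ℝ) ≤ N := by exact_mod_cast hN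
  have hlog2 := Real.log_le_log (by norm_num) hN'
  have hlog : Real.log (2 * N) ≤ 2 * plog N := by
    have h1 : Real.logb 2 N ≤ plog N := le_max_right _ _
    have h2 : Real.log N ≤ Real.logb 2 N := by
      rw [Real.logb, le_div_iff₀ (Real.log_pos (by norm_num))]
      have := Real.log_two_lt_d9
      nlinarith [Real.log_pos (show (1 : ℝ) < 2 by norm_num)]
    rw [Real.log_mul (by norm_num) (by positivity)]
    linarith
  have hlog0 : 0 ≤ Real.log (2 * N) := Real.log_nonneg (by linarith)
  refine ⟨⌈Real.log (2 * N) / c⌉₊, ?_, fun n hn => ?_⟩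
  · have h1 := (Nat.ceil_lt_add_one (div_nonneg hlog0 hc.le)).le
    have h2 : Real.log (2 * N) / c ≤ 2 / c * plog N := by
      rw [div_mul_eq_mul_div]
      gcongr
    linarith [one_le_plog N]
  · have h1 : Real.log (2 * N) ≤ n * c := (div_le_iff₀ hc).1 (Nat.ceil_le.1 hn)
    have h2 : 2 * N * A ^ n ≤ 1 := by
      have hpos : (0 : ℝ) < 2 * N * A ^ n := by positivity
      rw [← Real.log_nonpos_iff hpos.le, Real.log_mul (by positivity) (by positivity), Real.log_pow]
      linarith
    have h3 : Real.sin (θ n) ≤ A ^ n * 2 := (Real.sin_le (hθ n).1.le).trans (hpow n)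
    calc N * Real.sin (θ n) ≤ N * (A ^ n * 2) := by gcongr
      _ ≤ 1 := by linarith

lemma gridIn_unitSq {N : ℕ} (S : Finset (Fin N × Fin N)) : gridIn S unitSq = S := by
  ext i
  simp [mem_gridIn, gridPt_mem_unitSq]

lemma rect_zero_one_one : rect 0 (0, 0) 1 1 = unitSq := by
  ext z
  simp only [mem_rect_zero, unitSq, Set.mem_prod, Set.mem_Icc, zero_add]

lemma ncard_image_gridPt_inter {N : ℕ} (hN : 0 < N) (S : Finset (Fin N × Fin N))
    (R : Set (ℝ × ℝ)) :
    (((S.image (gridPt N) : Finset (ℝ × ℝ)) : Set (ℝ × ℝ)) ∩ R).ncard = (gridIn S R).card := by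
  rw [← Finset.card_image_of_injective (gridIn S R) (gridPt_injective hN), ← Set.ncard_coe_finset]
  congr 1
  ext z
  simp only [Set.mem_inter_iff, Finset.mem_coe, Finset.mem_image, mem_gridIn]
  constructor
  · rintro ⟨⟨i, hi, rfl⟩, hR⟩
    exact ⟨i, ⟨hi, hR⟩, rfl⟩
  · rintro ⟨i, ⟨hi, hR⟩, rfl⟩
    exact ⟨⟨i, hi, rfl⟩, hR⟩

/-- A random `N`-point subset of the grid has small mean square discrepancy on each rectangle
pointing in a direction of a lacunary sequence. -/
lemma exists_random_points_lacunary {θ : ℕ → ℝ} (hθ : ∀ n, θ n ∈ Set.Ioc 0 (Real.pi / 2))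
    {N m L : ℕ}
    (hN : 0 < N) (hL : N ^ 2 < 2 ^ L) (hL0 : 0 < L) (hm : ∀ n, m ≤ n → N * Real.sin (θ n) ≤ 1) :
    ∃ (ν : Finset (Fin N × Fin N) → ℝ) (V : Finset (Fin N × Fin N) → Finset (Fin N × Fin N)),
      (∀ S, 0 ≤ ν S) ∧ ∑ S, ν S = 1 ∧ (∀ S, (V S).card = N) ∧
      ∀ t ∈ paramSet (Set.range θ),
        ∑ S, ν S * gridDisc (V S) t.1 t.2.1 t.2.2.1 t.2.2.2 ^ 2 ≤
          14 * (32 * ((m : ℝ) + 1) * (L : ℝ) ^ 4 + 1152) + 24 := by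
  obtain ⟨ν, hν, hν1, hdisc⟩ := exists_random_grid_subset
    (fun d : Option (Fin m) => d.elim 0 fun n => θ n) hN hL hL0
  choose V hV hclose using exists_card_eq_gridIn_close (N := N)
  rw [Fintype.card_option, Fintype.card_fin, Nat.cast_add, Nat.cast_one] at hdisc
  set B := 32 * ((m : ℝ) + 1) * (L : ℝ) ^ 4 + 1152
  have hB : 0 ≤ B := by positivity
  have hcard : ∑ S : Finset (Fin N × Fin N), ν S * ((S.card : ℝ) - N) ^ 2 ≤ B := by
    have := hdisc none (0, 0) 1 1 (by simp) (by simp) rect_zero_one_one.subset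
    simpa [gridDisc, rect_zero_one_one, gridIn_unitSq] using this
  refine ⟨ν, V, hν, hν1, hV, ?_⟩
  rintro ⟨φ, p, w, h⟩ ⟨-, hφ, -, hw, hh, hR⟩
  dsimp only at hφ hw hh hR ⊢
  have hw' := Set.Ioc_subset_Icc_self hw
  have hh' := Set.Ioc_subset_Icc_self hh
  have hmain : ∑ S, ν S * gridDisc S φ p w h ^ 2 ≤ 6 * B + 12 := by
    rcases hφ with ⟨n, rfl⟩ | rfl
    · by_cases hn : n < m
      · have := hdisc (some ⟨n, hn⟩) p w h hw' hh' hR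
        dsimp only [Option.elim] at this
        linarith
      · have hpi := Real.pi_pos
        obtain ⟨q, a, b, q', a', b', ⟨ha, hb, hq⟩, ⟨ha', hb', hq'⟩, hle⟩ :=
            exists_boxes_gridDisc_le
          (Real.cos_nonneg_of_neg_pi_div_two_le_of_le (by linarith [(hθ n).1]) (hθ n).2)
          (Real.sin_nonneg_of_nonneg_of_le_pi (hθ n).1.le (by linarith [(hθ n).2]))
          (hm n (not_lt.1 hn)) hw' hh' hR
        have h1 := hdisc none q a b ha hb hq
        have h2 := hdisc none q' a' b' ha' hb' hq'
        dsimp only [Option.elim] at h1 h2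
        calc ∑ S, ν S * gridDisc S (θ n) p w h ^ 2
            ≤ ∑ S, (3 * (ν S * gridDisc S 0 q a b ^ 2) + 3 * (ν S * gridDisc S 0 q' a' b' ^ 2) +
                12 * ν S) := by
              refine Finset.sum_le_sum fun S _ => ?_
              have h3 : gridDisc S (θ n) p w h ^ 2 ≤
                  3 * gridDisc S 0 q a b ^ 2 + 3 * gridDisc S 0 q' a' b' ^ 2 + 12 := by
                rw [← sq_abs, ← sq_abs (gridDisc S 0 q a b), ← sq_abs (gridDisc S 0 q' a' b')]
                have h4 := pow_le_pow_left₀ (abs_nonneg _) (hle S) 2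
                nlinarith [sq_nonneg (|gridDisc S 0 q a b| - |gridDisc S 0 q' a' b'|),
                  sq_nonneg (|gridDisc S 0 q a b| - 2), sq_nonneg (|gridDisc S 0 q' a' b'| - 2)]
              nlinarith [mul_le_mul_of_nonneg_left h3 (hν S)]
          _ ≤ 6 * B + 12 := by
              simp only [Finset.sum_add_distrib, ← Finset.mul_sum, hν1]
              linarith
    · have := hdisc none p w h hw' hh' hR
      dsimp only [Option.elim] at this
      linarith
  calc ∑ S, ν S * gridDisc (V S) φ p w h ^ 2
      ≤ ∑ S, (2 * (ν S * gridDisc S φ p w h ^ 2) + 2 * (ν S * ((S.card : ℝ) - N) ^ 2)) := by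
        refine Finset.sum_le_sum fun S _ => ?_
        have h1 := sq_le_sq.2 (hclose S (rect φ p w h))
        have h2 : gridDisc (V S) φ p w h ^ 2 ≤
            2 * gridDisc S φ p w h ^ 2 + 2 * ((S.card : ℝ) - N) ^ 2 := by
          simp only [gridDisc]
          set x : ℝ := ((gridIn (V S) (rect φ p w h)).card : ℝ)
          set y : ℝ := ((gridIn S (rect φ p w h)).card : ℝ)
          nlinarith [sq_nonneg ((y - N * (w * h)) - (x - y))]
        nlinarith [mul_le_mul_of_nonneg_left h2 (hν S)]
    _ ≤ 14 * B + 24 := by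
        simp only [Finset.sum_add_distrib, ← Finset.mul_sum]
        linarith

lemma exists_pow_cutoff (N : ℕ) :
    ∃ L : ℕ, 0 < L ∧ N ^ 2 < 2 ^ L ∧ (L : ℝ) ≤ 3 * plog N := by
  refine ⟨Nat.log 2 (N ^ 2) + 1, Nat.succ_pos _, Nat.lt_pow_succ_log_self (by norm_num) _, ?_⟩
  have h1 := Real.natLog_le_logb (N ^ 2) 2
  have h2 : Real.logb 2 N ≤ plog N := le_max_right _ _
  push_cast [Real.logb_pow] at h1 ⊢
  linarith [one_le_plog N]

end Assembly

/-- If `Ω = {θ n}` is a lacunary sequence in `(0, π/2]`, then for every `N ≥ 2` and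
every probability measure `μ` on the parameter space of rectangles pointing in the
directions of `Ω ∪ {0}` and contained in `[0,1]²`, there is an `N`-point set
`P ⊆ [0,1]²` whose `L²(μ)`-discrepancy is at most `C (log N)^{5/2}`. -/
theorem L2_discrepancy_lacunary
    (θ : ℕ → ℝ) (A : ℝ) (hA0 : 0 < A) (hA1 : A < 1)
    (hθ : ∀ n, θ n ∈ Set.Ioc 0 (Real.pi / 2))
    (hlac : ∀ n, θ (n + 1) ≤ A * θ n) :
    ∃ C : ℝ, 0 < C ∧ ∀ N : ℕ, 2 ≤ N →
      ∀ μ : Measure (paramSet (Set.range θ)), IsProbabilityMeasure μ →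
        ∃ P : Finset (ℝ × ℝ), P.card = N ∧ (P : Set (ℝ × ℝ)) ⊆ unitSq ∧
          Real.sqrt (∫ t, (|(((P : Set (ℝ × ℝ)) ∩
                rect t.1.1 t.1.2.1 t.1.2.2.1 t.1.2.2.2).ncard : ℝ) -
              (N : ℝ) * (volume (rect t.1.1 t.1.2.1 t.1.2.2.1 t.1.2.2.2)).toReal|) ^ 2 ∂μ)
            ≤ C * (plog N) ^ ((5 : ℝ) / 2) := by
  obtain ⟨K, hK, hcut⟩ := exists_lacunary_cutoff hA0 hA1 hθ hlac
  refine ⟨√(14 * (32 * 81 * K + 1152) + 24), by positivity, fun N hN μ hμ => ?_⟩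
  have hN0 : 0 < N := by lia
  obtain ⟨m, hm, hsin⟩ := hcut N hN
  obtain ⟨L, hL0, hL, hLle⟩ := exists_pow_cutoff N
  obtain ⟨ν, V, hν, hν1, hV, hsum⟩ := exists_random_points_lacunary hθ hN0 hL hL0 hsin
  obtain ⟨S, hS⟩ := exists_integral_le_of_weighted_sum_le μ (by positivity) hν hν1
    fun t : paramSet (Set.range θ) => hsum t.1 t.2
  refine ⟨(V S).image (gridPt N), ?_, ?_, ?_⟩
  · rw [Finset.card_image_of_injective _ (gridPt_injective hN0), hV]
  · simp only [Finset.coe_image, Set.image_subset_iff]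
    exact fun i _ => gridPt_mem_unitSq i
  have hplog := one_le_plog N
  have hbound : 14 * (32 * ((m : ℝ) + 1) * (L : ℝ) ^ 4 + 1152) + 24 ≤
      (14 * (32 * 81 * K + 1152) + 24) * plog N ^ 5 := by
    have h1 : ((m : ℝ) + 1) * (L : ℝ) ^ 4 ≤ K * plog N * (3 * plog N) ^ 4 := by gcongr
    have h2 : 1 ≤ plog N ^ 5 := one_le_pow₀ hplog
    nlinarith
  have hpow : plog N ^ ((5 : ℝ) / 2) = √(plog N ^ 5) := by
    rw [Real.sqrt_eq_rpow, ← Real.rpow_natCast, ← Real.rpow_mul (by linarith)]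
    norm_num
  rw [hpow, ← Real.sqrt_mul (by positivity)]
  refine Real.sqrt_le_sqrt ((le_of_eq ?_).trans (hS.trans hbound))
  refine integral_congr_ae (Filter.Eventually.of_forall fun t => ?_)
  obtain ⟨-, -, -, hw, hh, -⟩ := t.2
  dsimp only
  rw [sq_abs, ncard_image_gridPt_inter hN0, volume_rect _ _ _ hw.1.le,
    ENNReal.toReal_ofReal (mul_nonneg hw.1.le hh.1.le), gridDisc]

end
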